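/- There exists a constant C > 0 such that for every n and every simple graph G on n vertices with independence number at most 2, 2·N(G₂;G) + 3·N(G₃;G) + C·n⁴ ≥ N(G₅;G) + N(G₈;G) + 4·N(G₉;G) + 2·N(G₁₀;G) + 5·N(G₁₁;G), where the 5-vertex graphs on vertex set {1,...,5} are given by their edge sets: G₂ = {15,23,24,34,35,45}, G₃ = {15,23,24,25,34,35,45}, G₅ = {13,15,24,25,34,35,45}, G₈ = {12,25,34,35,45}, G₉ = {12,15,25,34,35,45}, G₁₀ = {12,14,25,34,35,45}, and G₁₁ = {12,13,24,35,45} (the 5-cycle). -/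

import Mathlib

/-- `G` has no independent set with more than `m` vertices, i.e. α(G) ≤ m. -/
def IndepBound {V : Type*} (G : SimpleGraph V) (m : ℕ) : Prop :=
  ∀ s : Finset V, (∀ u ∈ s, ∀ v ∈ s, u ≠ v → ¬ G.Adj u v) → s.card ≤ m

/-- the number of vertex subsets of `G` whose induced subgraph is isomorphic to `H`. -/
noncomputable def copyCount {V W : Type*} [Fintype V] [Fintype W]
    (H : SimpleGraph W) (G : SimpleGraph V) : ℕ :=
  Nat.card {s : Finset V // Nonempty (H ≃g G.induce (s : Set V))}

/-- a 5-vertex graph given by a list of edges on {0,…,4}. -/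
def graphOf (l : List (Fin 5 × Fin 5)) : SimpleGraph (Fin 5) :=
  SimpleGraph.fromRel (fun a b => (a, b) ∈ l)

/-- G₂, edges {15,23,24,34,35,45} (1-indexed). -/
def graphG2 : SimpleGraph (Fin 5) :=
  graphOf [(0, 4), (1, 2), (1, 3), (2, 3), (2, 4), (3, 4)]

/-- G₃, edges {15,23,24,25,34,35,45}. -/
def graphG3 : SimpleGraph (Fin 5) :=
  graphOf [(0, 4), (1, 2), (1, 3), (1, 4), (2, 3), (2, 4), (3, 4)]

/-- G₅, edges {13,15,24,25,34,35,45}. -/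
def graphG5 : SimpleGraph (Fin 5) :=
  graphOf [(0, 2), (0, 4), (1, 3), (1, 4), (2, 3), (2, 4), (3, 4)]

/-- G₈, edges {12,25,34,35,45}. -/
def graphG8 : SimpleGraph (Fin 5) :=
  graphOf [(0, 1), (1, 4), (2, 3), (2, 4), (3, 4)]

/-- G₉, edges {12,15,25,34,35,45}. -/
def graphG9 : SimpleGraph (Fin 5) :=
  graphOf [(0, 1), (0, 4), (1, 4), (2, 3), (2, 4), (3, 4)]

/-- G₁₀, edges {12,14,25,34,35,45}. -/
def graphG10 : SimpleGraph (Fin 5) :=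
  graphOf [(0, 1), (0, 3), (1, 4), (2, 3), (2, 4), (3, 4)]

/-- G₁₁ = C₅, edges {12,13,24,35,45}. -/
def graphG11 : SimpleGraph (Fin 5) :=
  graphOf [(0, 1), (0, 2), (1, 3), (2, 4), (3, 4)]

/-- The adjacencies of a graph on `Fin 5`, listed pair by pair. -/
structure Pattern where
  (e01 e02 e03 e04 e12 e13 e14 e23 e24 e34 : Bool)
  deriving DecidableEq

namespace Pattern

/-- Relabelling along the cyclic shift of the first two vertices. -/
def rotTwo : Pattern → Pattern
  | ⟨e01, e02, e03, e04, e12, e13, e14, e23, e24, e34⟩ =>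
    ⟨e01, e12, e13, e14, e02, e03, e04, e23, e24, e34⟩

/-- Relabelling along the cyclic shift of the first three vertices. -/
def rotThree : Pattern → Pattern
  | ⟨e01, e02, e03, e04, e12, e13, e14, e23, e24, e34⟩ =>
    ⟨e12, e01, e13, e14, e02, e23, e24, e03, e04, e34⟩

/-- Relabelling along the cyclic shift of the first four vertices. -/
def rotFour : Pattern → Pattern
  | ⟨e01, e02, e03, e04, e12, e13, e14, e23, e24, e34⟩ =>
    ⟨e12, e13, e01, e14, e23, e02, e24, e03, e34, e04⟩

/-- Relabelling along the cyclic shift of the first five vertices. -/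
def rotFive : Pattern → Pattern
  | ⟨e01, e02, e03, e04, e12, e13, e14, e23, e24, e34⟩ =>
    ⟨e12, e13, e14, e01, e23, e24, e02, e34, e03, e04⟩

/-- The sum of `φ` over the cyclic shifts of the first two vertices. -/
def sumTwo (φ : Pattern → ℤ) (p : Pattern) : ℤ := φ p + φ p.rotTwo

/-- The sum of `φ` over the cyclic shifts of the first three vertices. -/
def sumThree (φ : Pattern → ℤ) (p : Pattern) : ℤ :=
  φ p + φ p.rotThree + φ p.rotThree.rotThree

/-- The sum of `φ` over the cyclic shifts of the first four vertices. -/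
def sumFour (φ : Pattern → ℤ) (p : Pattern) : ℤ :=
  φ p + φ p.rotFour + φ p.rotFour.rotFour + φ p.rotFour.rotFour.rotFour

/-- The sum of `φ` over the cyclic shifts of all five vertices. -/
def sumFive (φ : Pattern → ℤ) (p : Pattern) : ℤ :=
  φ p + φ p.rotFive + φ p.rotFive.rotFive + φ p.rotFive.rotFive.rotFive +
    φ p.rotFive.rotFive.rotFive.rotFive

/-- The sum of `φ` over all 120 relabellings of a pattern. -/
def symm (φ : Pattern → ℤ) : Pattern → ℤ := sumFive (sumFour (sumThree (sumTwo φ)))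

/-- The pattern has no independent triple. -/
def Dense (p : Pattern) : Prop :=
  (p.e01 || p.e02 || p.e12) ∧ (p.e01 || p.e03 || p.e13) ∧ (p.e01 || p.e04 || p.e14) ∧
  (p.e02 || p.e03 || p.e23) ∧ (p.e02 || p.e04 || p.e24) ∧ (p.e03 || p.e04 || p.e34) ∧
  (p.e12 || p.e13 || p.e23) ∧ (p.e12 || p.e14 || p.e24) ∧ (p.e13 || p.e14 || p.e34) ∧
  (p.e23 || p.e24 || p.e34)

instance (p : Pattern) : Decidable p.Dense := by unfold Dense; infer_instance

/-- If `0` is a common neighbour of the nonadjacent vertices `1` and `2`, the product over the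
vertices `w = 3, 4` of the differences `[w ∼ 1] - [w ∼ 2]`; otherwise zero. -/
def square (p : Pattern) : ℤ :=
  if p.e01 && p.e02 && !p.e12 then
    (p.e13.toInt - p.e23.toInt) * (p.e14.toInt - p.e24.toInt) else 0

/-- Four times the coefficient of each target graph, divided by its number of automorphisms. -/
def weight : Pattern → ℤ
  | ⟨false, false, false, true, true, true, false, true, true, true⟩ => 4
  | ⟨false, false, false, true, true, true, true, true, true, true⟩ => 2
  | ⟨false, true, false, true, false, true, true, true, true, true⟩ => -2
  | ⟨true, false, false, false, false, false, true, true, true, true⟩ => -2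
  | ⟨true, false, false, true, false, false, true, true, true, true⟩ => -2
  | ⟨true, false, true, false, false, false, true, true, true, true⟩ => -4
  | ⟨true, true, false, false, false, true, false, false, true, true⟩ => -2
  | _ => 0

theorem weight_eq_sum (p : Pattern) :
    weight p =
        4 * (if p = ⟨false, false, false, true, true, true, false, true, true, true⟩ then 1 else 0)
      + 2 * (if p = ⟨false, false, false, true, true, true, true, true, true, true⟩ then 1 else 0)
      - 2 * (if p = ⟨false, true, false, true, false, true, true, true, true, true⟩ then 1 else 0)
      - 2 * (if p = ⟨true, false, false, false, false, false, true, true, true, true⟩ then 1 else 0)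
      - 2 * (if p = ⟨true, false, false, true, false, false, true, true, true, true⟩ then 1 else 0)
      - 4 * (if p = ⟨true, false, true, false, false, false, true, true, true, true⟩ then 1 else 0)
      - 2 * (if p = ⟨true, true, false, false, false, true, false, false, true, true⟩ then 1 else 0) := by
  obtain ⟨a, b, c, d, e, f, g, h, i, j⟩ := p
  revert a b c d e f g h i j
  decide +kernel

theorem symm_weight {p : Pattern} (hp : p.Dense) : symm weight p = symm square p := by
  obtain ⟨a, b, c, d, e, f, g, h, i, j⟩ := p
  revert a b c d e f g h i j
  decide +kernel

end Pattern

/-- The pattern of a graph on `Fin 5`. -/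
noncomputable def patternOf (A : SimpleGraph (Fin 5)) : Pattern :=
  open Classical in
  ⟨A.Adj 0 1, A.Adj 0 2, A.Adj 0 3, A.Adj 0 4, A.Adj 1 2, A.Adj 1 3, A.Adj 1 4, A.Adj 2 3,
    A.Adj 2 4, A.Adj 3 4⟩

theorem patternOf_injective : Function.Injective patternOf := by
  intro A B h
  simp only [patternOf, Pattern.mk.injEq, decide_eq_decide] at h
  have key : ∀ a b : Fin 5, a < b → (A.Adj a b ↔ B.Adj a b) := by
    intro a b hab
    fin_cases a <;> fin_cases b <;> first | exact absurd hab (by decide) | simp [h]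
  ext a b
  rcases lt_trichotomy a b with hab | rfl | hab
  · exact key a b hab
  · simp
  · rw [A.adj_comm, B.adj_comm, key b a hab]

theorem patternOf_graphG2 :
    patternOf graphG2 =
      ⟨false, false, false, true, true, true, false, true, true, true⟩ := by
  simp [patternOf, graphG2, graphOf]

theorem patternOf_graphG3 :
    patternOf graphG3 =
      ⟨false, false, false, true, true, true, true, true, true, true⟩ := by
  simp [patternOf, graphG3, graphOf]

theorem patternOf_graphG5 :
    patternOf graphG5 =
      ⟨false, true, false, true, false, true, true, true, true, true⟩ := by
  simp [patternOf, graphG5, graphOf]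

theorem patternOf_graphG8 :
    patternOf graphG8 =
      ⟨true, false, false, false, false, false, true, true, true, true⟩ := by
  simp [patternOf, graphG8, graphOf]

theorem patternOf_graphG9 :
    patternOf graphG9 =
      ⟨true, false, false, true, false, false, true, true, true, true⟩ := by
  simp [patternOf, graphG9, graphOf]

theorem patternOf_graphG10 :
    patternOf graphG10 =
      ⟨true, false, true, false, false, false, true, true, true, true⟩ := by
  simp [patternOf, graphG10, graphOf]

theorem patternOf_graphG11 :
    patternOf graphG11 =
      ⟨true, true, false, false, false, true, false, false, true, true⟩ := by
  simp [patternOf, graphG11, graphOf]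

theorem sum_comap_perm {V W M : Type*} [Fintype V] [Fintype W] [DecidableEq W] [AddCommMonoid M]
    (G : SimpleGraph V) (c : Equiv.Perm W) (φ : SimpleGraph W → M) :
    ∑ f : W ↪ V, φ ((G.comap f).comap c) = ∑ f : W ↪ V, φ (G.comap f) :=
  (Equiv.embeddingCongr c.symm (Equiv.refl V)).sum_comp fun f => φ (G.comap f)

theorem rotTwo_patternOf (A : SimpleGraph (Fin 5)) :
    (patternOf A).rotTwo = patternOf (A.comap
      (⟨![1, 0, 2, 3, 4], ![1, 0, 2, 3, 4], by decide, by decide⟩ : Equiv.Perm (Fin 5))) := by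
  simp [patternOf, Pattern.rotTwo, A.adj_comm]

theorem sum_rotTwo {V : Type*} [Fintype V] (G : SimpleGraph V) (φ : Pattern → ℤ) :
    ∑ f : Fin 5 ↪ V, φ (patternOf (G.comap f)).rotTwo =
      ∑ f : Fin 5 ↪ V, φ (patternOf (G.comap f)) := by
  simp only [rotTwo_patternOf]
  exact sum_comap_perm G _ fun A => φ (patternOf A)

theorem rotThree_patternOf (A : SimpleGraph (Fin 5)) :
    (patternOf A).rotThree = patternOf (A.comap
      (⟨![1, 2, 0, 3, 4], ![2, 0, 1, 3, 4], by decide, by decide⟩ : Equiv.Perm (Fin 5))) := by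
  simp [patternOf, Pattern.rotThree, A.adj_comm]

theorem sum_rotThree {V : Type*} [Fintype V] (G : SimpleGraph V) (φ : Pattern → ℤ) :
    ∑ f : Fin 5 ↪ V, φ (patternOf (G.comap f)).rotThree =
      ∑ f : Fin 5 ↪ V, φ (patternOf (G.comap f)) := by
  simp only [rotThree_patternOf]
  exact sum_comap_perm G _ fun A => φ (patternOf A)

theorem rotFour_patternOf (A : SimpleGraph (Fin 5)) :
    (patternOf A).rotFour = patternOf (A.comap
      (⟨![1, 2, 3, 0, 4], ![3, 0, 1, 2, 4], by decide, by decide⟩ : Equiv.Perm (Fin 5))) := by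
  simp [patternOf, Pattern.rotFour, A.adj_comm]

theorem sum_rotFour {V : Type*} [Fintype V] (G : SimpleGraph V) (φ : Pattern → ℤ) :
    ∑ f : Fin 5 ↪ V, φ (patternOf (G.comap f)).rotFour =
      ∑ f : Fin 5 ↪ V, φ (patternOf (G.comap f)) := by
  simp only [rotFour_patternOf]
  exact sum_comap_perm G _ fun A => φ (patternOf A)

theorem rotFive_patternOf (A : SimpleGraph (Fin 5)) :
    (patternOf A).rotFive = patternOf (A.comap
      (⟨![1, 2, 3, 4, 0], ![4, 0, 1, 2, 3], by decide, by decide⟩ : Equiv.Perm (Fin 5))) := by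
  simp [patternOf, Pattern.rotFive, A.adj_comm]

theorem sum_rotFive {V : Type*} [Fintype V] (G : SimpleGraph V) (φ : Pattern → ℤ) :
    ∑ f : Fin 5 ↪ V, φ (patternOf (G.comap f)).rotFive =
      ∑ f : Fin 5 ↪ V, φ (patternOf (G.comap f)) := by
  simp only [rotFive_patternOf]
  exact sum_comap_perm G _ fun A => φ (patternOf A)

theorem sum_symm {V : Type*} [Fintype V] (G : SimpleGraph V) (φ : Pattern → ℤ) :
    ∑ f : Fin 5 ↪ V, Pattern.symm φ (patternOf (G.comap f)) =
      120 * ∑ f : Fin 5 ↪ V, φ (patternOf (G.comap f)) := by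
  have h₂ (ψ : Pattern → ℤ) : ∑ f : Fin 5 ↪ V, Pattern.sumTwo ψ (patternOf (G.comap f)) =
      2 * ∑ f : Fin 5 ↪ V, ψ (patternOf (G.comap f)) := by
    simp only [Pattern.sumTwo, Finset.sum_add_distrib]
    rw [sum_rotTwo G ψ]
    ring
  have h₃ (ψ : Pattern → ℤ) : ∑ f : Fin 5 ↪ V, Pattern.sumThree ψ (patternOf (G.comap f)) =
      3 * ∑ f : Fin 5 ↪ V, ψ (patternOf (G.comap f)) := by
    simp only [Pattern.sumThree, Finset.sum_add_distrib]
    rw [sum_rotThree G fun p => ψ p.rotThree,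
      sum_rotThree G ψ]
    ring
  have h₄ (ψ : Pattern → ℤ) : ∑ f : Fin 5 ↪ V, Pattern.sumFour ψ (patternOf (G.comap f)) =
      4 * ∑ f : Fin 5 ↪ V, ψ (patternOf (G.comap f)) := by
    simp only [Pattern.sumFour, Finset.sum_add_distrib]
    rw [sum_rotFour G fun p => ψ p.rotFour.rotFour,
      sum_rotFour G fun p => ψ p.rotFour,
      sum_rotFour G ψ]
    ring
  have h₅ (ψ : Pattern → ℤ) : ∑ f : Fin 5 ↪ V, Pattern.sumFive ψ (patternOf (G.comap f)) =
      5 * ∑ f : Fin 5 ↪ V, ψ (patternOf (G.comap f)) := by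
    simp only [Pattern.sumFive, Finset.sum_add_distrib]
    rw [sum_rotFive G fun p => ψ p.rotFive.rotFive.rotFive,
      sum_rotFive G fun p => ψ p.rotFive.rotFive,
      sum_rotFive G fun p => ψ p.rotFive,
      sum_rotFive G ψ]
    ring
  rw [Pattern.symm, h₅, h₄, h₃, h₂]
  ring

theorem dense_patternOf_comap {V : Type*} {G : SimpleGraph V} (hG : IndepBound G 2)
    (f : Fin 5 ↪ V) : (patternOf (G.comap f)).Dense := by
  classical
  have key : ∀ i j k : Fin 5, i ≠ j → i ≠ k → j ≠ k →
      (G.Adj (f i) (f j) ∨ G.Adj (f i) (f k)) ∨ G.Adj (f j) (f k) := by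
    intro i j k hij hik hjk
    by_contra! h
    obtain ⟨⟨h₁, h₂⟩, h₃⟩ := h
    have hcard := hG {f i, f j, f k} (by
      simp [h₁, h₂, h₃, G.adj_comm (f j) (f i), G.adj_comm (f k)])
    rw [Finset.card_eq_three.mpr ⟨f i, f j, f k, by simpa, by simpa, by simpa, rfl⟩] at hcard
    omega
  simp only [Pattern.Dense, patternOf, SimpleGraph.comap_adj, Bool.or_eq_true, decide_eq_true_eq]
  refine ⟨?_, ?_, ?_, ?_, ?_, ?_, ?_, ?_, ?_, ?_⟩ <;>
    exact key _ _ _ (by decide) (by decide) (by decide)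

/-- The embeddings with a given range are the isomorphisms onto the graph induced on it. -/
noncomputable def embeddingFiberEquiv {V W : Type*} (H : SimpleGraph W) (G : SimpleGraph V)
    (s : Set V) : {e : H ↪g G // Set.range e = s} ≃ (H ≃g G.induce s) where
  toFun e :=
    { toEquiv := (Equiv.ofInjective e.1 e.1.injective).trans (Equiv.setCongr e.2)
      map_rel_iff' := e.1.map_rel_iff }
  invFun i := ⟨(SimpleGraph.Embedding.induce s).comp i.toEmbedding, by
    ext v
    constructor
    · rintro ⟨w, rfl⟩
      exact (i w).2
    · intro hv
      exact ⟨i.symm ⟨v, hv⟩, by simp⟩⟩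
  left_inv e := by ext; rfl
  right_inv i := by ext; rfl

theorem card_embedding {V W : Type*} [Fintype V] [Fintype W]
    (H : SimpleGraph W) (G : SimpleGraph V) :
    Nat.card (H ↪g G) = Nat.card (H ≃g H) * copyCount H G := by
  classical
  let F : (H ↪g G) → {s : Finset V // Nonempty (H ≃g G.induce (s : Set V))} := fun e =>
    ⟨Finset.univ.image e, ⟨embeddingFiberEquiv H G _ ⟨e, by simp⟩⟩⟩
  have hF (s) : Nat.card {e // F e = s} = Nat.card (H ≃g H) := by
    obtain ⟨s, ⟨i⟩⟩ := s
    have h₁ : {e // F e = ⟨s, ⟨i⟩⟩} ≃ {e : H ↪g G // Set.range e = s} :=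
      Equiv.subtypeEquivRight fun e => by
        rw [Subtype.mk.injEq, ← Finset.coe_inj]
        simp
    have h₂ : (H ≃g G.induce (s : Set V)) ≃ (H ≃g H) :=
      ⟨fun j => j.trans i.symm, fun j => j.trans i, fun j => by ext; simp, fun j => by ext; simp⟩
    exact Nat.card_congr (h₁.trans ((embeddingFiberEquiv H G s).trans h₂))
  have : Finite (H ↪g G) := Finite.of_injective _ DFunLike.coe_injective
  rw [Nat.card_congr (Equiv.sigmaFiberEquiv F).symm, Nat.card_sigma]
  simp only [hF, Finset.sum_const, Finset.card_univ, smul_eq_mul, copyCount,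
    Nat.card_eq_fintype_card, mul_comm]

/-- Embeddings of `H` are injections pulling `G` back to `H`. -/
def embeddingEquivComap {V W : Type*} (H : SimpleGraph W) (G : SimpleGraph V) :
    (H ↪g G) ≃ {f : W ↪ V // G.comap f = H} where
  toFun e := ⟨e.toEmbedding, by ext; simp⟩
  invFun f := ⟨f.1, by simp [← f.2]⟩
  left_inv e := rfl
  right_inv f := rfl

theorem sum_comap_eq {V : Type*} [Fintype V] (H : SimpleGraph (Fin 5)) (G : SimpleGraph V) :
    ∑ f : Fin 5 ↪ V, (if patternOf (G.comap f) = patternOf H then (1 : ℤ) else 0) =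
      Nat.card (H ≃g H) * copyCount H G := by
  classical
  rw [← Nat.cast_mul, ← card_embedding, Nat.card_congr (embeddingEquivComap H G),
    Nat.card_eq_fintype_card, Fintype.card_subtype, Finset.sum_boole]
  simp only [patternOf_injective.eq_iff]

theorem card_iso_self {W : Type*} [Fintype W] [DecidableEq W] (H : SimpleGraph W)
    [DecidableRel H.Adj] : Nat.card (H ≃g H) =
      Fintype.card {π : Equiv.Perm W // ∀ a b, H.Adj (π a) (π b) ↔ H.Adj a b} := by
  rw [← Nat.card_eq_fintype_card]
  exact Nat.card_congr
    ⟨fun e => ⟨e.toEquiv, fun _ _ => e.map_rel_iff⟩, fun π => ⟨π.1, π.2 _ _⟩,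
      fun _ => rfl, fun _ => rfl⟩

instance (l : List (Fin 5 × Fin 5)) : DecidableRel (graphOf l).Adj := fun a b =>
  inferInstanceAs (Decidable (a ≠ b ∧ ((a, b) ∈ l ∨ (b, a) ∈ l)))

theorem card_iso_graphG2 : Nat.card (graphG2 ≃g graphG2) = 2 := by
  rw [graphG2, card_iso_self]
  decide +kernel

theorem card_iso_graphG3 : Nat.card (graphG3 ≃g graphG3) = 6 := by
  rw [graphG3, card_iso_self]
  decide +kernel

theorem card_iso_graphG5 : Nat.card (graphG5 ≃g graphG5) = 2 := by
  rw [graphG5, card_iso_self]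
  decide +kernel

theorem card_iso_graphG8 : Nat.card (graphG8 ≃g graphG8) = 2 := by
  rw [graphG8, card_iso_self]
  decide +kernel

theorem card_iso_graphG9 : Nat.card (graphG9 ≃g graphG9) = 8 := by
  rw [graphG9, card_iso_self]
  decide +kernel

theorem card_iso_graphG10 : Nat.card (graphG10 ≃g graphG10) = 2 := by
  rw [graphG10, card_iso_self]
  decide +kernel

theorem card_iso_graphG11 : Nat.card (graphG11 ≃g graphG11) = 10 := by
  rw [graphG11, card_iso_self]
  decide +kernel

theorem sum_weight {V : Type*} [Fintype V] (G : SimpleGraph V) :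
    ∑ f : Fin 5 ↪ V, Pattern.weight (patternOf (G.comap f)) =
      4 * (2 * copyCount graphG2 G + 3 * copyCount graphG3 G - (copyCount graphG5 G +
        copyCount graphG8 G + 4 * copyCount graphG9 G + 2 * copyCount graphG10 G +
        5 * copyCount graphG11 G)) := by
  simp only [Pattern.weight_eq_sum, Finset.sum_add_distrib, Finset.sum_sub_distrib,
    ← Finset.mul_sum, ← patternOf_graphG2, ← patternOf_graphG3, ← patternOf_graphG5,
    ← patternOf_graphG8, ← patternOf_graphG9, ← patternOf_graphG10, ← patternOf_graphG11,
    sum_comap_eq, card_iso_graphG2, card_iso_graphG3, card_iso_graphG5, card_iso_graphG8,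
    card_iso_graphG9, card_iso_graphG10, card_iso_graphG11]
  push_cast
  ring

/-- Tuples of length five as nested pairs. -/
def tupleEquiv (V : Type*) : (V × V × V × V × V) ≃ (Fin 5 → V) where
  toFun t := ![t.1, t.2.1, t.2.2.1, t.2.2.2.1, t.2.2.2.2]
  invFun f := (f 0, f 1, f 2, f 3, f 4)
  left_inv t := rfl
  right_inv f := by ext i; fin_cases i <;> rfl

theorem neg_card_le_sum_offDiag {V : Type*} [Fintype V] [DecidableEq V] (g : V → ℤ)
    (hg : ∀ v, |g v| ≤ 1) :
    -(Fintype.card V : ℤ) ≤ ∑ v, ∑ w, if v ≠ w then g v * g w else 0 := by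
  have h (v w : V) : (if v ≠ w then g v * g w else 0) =
      g v * g w - if v = w then g v * g w else 0 := by
    split_ifs <;> simp_all
  simp only [h, Finset.sum_sub_distrib, Finset.sum_ite_eq, Finset.mem_univ, if_true,
    ← Finset.mul_sum, ← Finset.sum_mul]
  have hsq : ∑ v, g v * g v ≤ ∑ _v : V, 1 :=
    Finset.sum_le_sum fun v _ => by nlinarith [abs_le.mp (hg v)]
  simp only [Finset.sum_const, Finset.card_univ, nsmul_eq_mul, mul_one] at hsq
  nlinarith [mul_self_nonneg (∑ v, g v)]

theorem neg_card_pow_le_sum_square {V : Type*} [Fintype V] (G : SimpleGraph V) :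
    -(Fintype.card V : ℤ) ^ 4 ≤ ∑ f : Fin 5 ↪ V, Pattern.square (patternOf (G.comap f)) := by
  classical
  let F : (Fin 5 → V) → ℤ := fun f =>
    if Function.Injective f then Pattern.square (patternOf (G.comap f)) else 0
  have hF : ∑ f : Fin 5 ↪ V, Pattern.square (patternOf (G.comap f)) = ∑ f, F f := by
    rw [← Finset.sum_filter, Finset.sum_subtype _ (p := Function.Injective) (by simp)]
    exact ((Equiv.subtypeInjectiveEquivEmbedding (Fin 5) V).sum_comp
      fun f => Pattern.square (patternOf (G.comap f))).symm
  let g : V → V → V → V → ℤ := fun a b c w =>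
    if w ≠ a ∧ w ≠ b ∧ w ≠ c then
      (decide (G.Adj b w)).toInt - (decide (G.Adj c w)).toInt else 0
  have hterm (a b c v w : V) : F ![a, b, c, v, w] =
      if a ≠ b ∧ a ≠ c ∧ b ≠ c ∧ G.Adj a b ∧ G.Adj a c ∧ ¬ G.Adj b c then
        (if v ≠ w then g a b c v * g a b c w else 0) else 0 := by
    have hinj : Function.Injective ![a, b, c, v, w] ↔
        (a ≠ b ∧ a ≠ c ∧ b ≠ c) ∧ (v ≠ a ∧ v ≠ b ∧ v ≠ c) ∧ (w ≠ a ∧ w ≠ b ∧ w ≠ c) ∧ v ≠ w := by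
      rw [← List.nodup_ofFn]
      simp only [List.ofFn_succ, List.ofFn_zero, List.nodup_cons]
      simp
      grind
    have hpat : patternOf (G.comap ![a, b, c, v, w]) =
        ⟨G.Adj a b, G.Adj a c, G.Adj a v, G.Adj a w, G.Adj b c, G.Adj b v, G.Adj b w, G.Adj c v,
          G.Adj c w, G.Adj v w⟩ := rfl
    simp only [F, g, hinj, hpat, Pattern.square, Bool.and_eq_true, Bool.not_eq_true',
      decide_eq_true_eq, decide_eq_false_iff_not]
    grind
  have hinner (a b c : V) : -(Fintype.card V : ℤ) ≤ ∑ v, ∑ w, F ![a, b, c, v, w] := by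
    simp only [hterm]
    split_ifs
    · refine neg_card_le_sum_offDiag _ fun v => ?_
      simp only [g]
      split_ifs
      · cases decide (G.Adj b v) <;> cases decide (G.Adj c v) <;> decide
      · simp
    · simp
  rw [hF, ← (tupleEquiv V).sum_comp]
  simp only [Fintype.sum_prod_type]
  calc -(Fintype.card V : ℤ) ^ 4 = ∑ _a : V, ∑ _b : V, ∑ _c : V, -(Fintype.card V : ℤ) := by
        simp only [Finset.sum_const, Finset.card_univ, nsmul_eq_mul]
        ring
    _ ≤ _ := Finset.sum_le_sum fun a _ => Finset.sum_le_sum fun b _ =>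
        Finset.sum_le_sum fun c _ => hinner a b c

/-- There is C > 0 such that for every graph G with α(G) ≤ 2,
2·N(G₂;G) + 3·N(G₃;G) + C·n⁴ ≥ N(G₅;G) + N(G₈;G) + 4·N(G₉;G) + 2·N(G₁₀;G) + 5·N(G₁₁;G). -/
theorem flag_inequality_tau1 :
    ∃ C : ℝ, 0 < C ∧ ∀ n : ℕ, ∀ G : SimpleGraph (Fin n), IndepBound G 2 →
      (copyCount graphG5 G : ℝ) + (copyCount graphG8 G : ℝ)
          + 4 * (copyCount graphG9 G : ℝ) + 2 * (copyCount graphG10 G : ℝ)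
          + 5 * (copyCount graphG11 G : ℝ)
        ≤ 2 * (copyCount graphG2 G : ℝ) + 3 * (copyCount graphG3 G : ℝ)
          + C * (n : ℝ) ^ 4 := by
  refine ⟨1, one_pos, fun n G hG => ?_⟩
  have hsymm : ∑ f : Fin 5 ↪ Fin n, Pattern.symm Pattern.weight (patternOf (G.comap f)) =
      ∑ f : Fin 5 ↪ Fin n, Pattern.symm Pattern.square (patternOf (G.comap f)) :=
    Finset.sum_congr rfl fun f _ => Pattern.symm_weight (dense_patternOf_comap hG f)
  rw [sum_symm, sum_symm, sum_weight] at hsymm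
  have hsq := neg_card_pow_le_sum_square G
  rw [Fintype.card_fin] at hsq
  have hn : (0 : ℤ) ≤ (n : ℤ) ^ 4 := by positivity
  have key : (copyCount graphG5 G : ℤ) + copyCount graphG8 G + 4 * copyCount graphG9 G +
      2 * copyCount graphG10 G + 5 * copyCount graphG11 G ≤
      2 * copyCount graphG2 G + 3 * copyCount graphG3 G + 1 * (n : ℤ) ^ 4 := by
    linarith
  exact_mod_cast key
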